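/- Let G be a finite simple graph with vertex set of size n, t triangles (3-cliques), and let Δ denote the maximum, over all edges e of G, of the number of triangles of G containing e. Fix a constant γ > 0 and p ∈ (0,1]. Form the random subgraph G' by keeping each edge of G independently with probability p, and let T be the number of triangles of G'. Then for any constants K > 0 and ε > 0 there exists n₀ (depending on K, ε, γ) such that: if n ≥ n₀, p²Δ ≥ 1, and p·t/Δ ≥ (log n)^{6+γ}, then P(|T − E[T]| ≥ ε·E[T]) ≤ n^{−K}. -/

import Mathlib

open Finset

section Defs

variable {V : Type*} [Fintype V] [DecidableEq V]

/-- The weight of an outcome `ω` of independent coin flips, one for each coordinate,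
under the product of Bernoulli(p) measures: a kept coordinate (`ω e = true`)
contributes `p`, a discarded one contributes `1 - p`. -/
noncomputable def bernWeight {ι : Type*} [Fintype ι] (p : ℝ) (ω : ι → Bool) : ℝ :=
  ∏ e : ι, if ω e then p else 1 - p

/-- Expectation of `f` with respect to the product Bernoulli(p) measure. -/
noncomputable def bernExpect {ι : Type*} [Fintype ι] [DecidableEq ι]
    (p : ℝ) (f : (ι → Bool) → ℝ) : ℝ :=
  ∑ ω : ι → Bool, bernWeight p ω * f ω

open scoped Classical in
/-- Probability of the event `A` under the product Bernoulli(p) measure. -/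
noncomputable def bernProb {ι : Type*} [Fintype ι] [DecidableEq ι]
    (p : ℝ) (A : (ι → Bool) → Prop) : ℝ :=
  ∑ ω : ι → Bool, if A ω then bernWeight p ω else 0

/-- The triangle-counting random variable `T = Σ_{triangles {e,f,g}} X_e X_f X_g`:
the sum over all triangles (3-cliques) of `G` of the product, over the three edges
of the triangle, of the indicator that the edge is kept. -/
noncomputable def triCount (G : SimpleGraph V) [DecidableRel G.Adj]
    (ω : {e : Sym2 V // e ∈ G.edgeFinset} → Bool) : ℝ :=
  ∑ s ∈ G.cliqueFinset 3,
    ∏ e ∈ univ.filter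
        (fun e : {e : Sym2 V // e ∈ G.edgeFinset} => (e : Sym2 V) ∈ s.sym2),
      (if ω e then (1 : ℝ) else 0)

/-- `Δ(e)`: the number of triangles (3-cliques) of `G` containing the edge `e`. -/
def triEdgeCount (G : SimpleGraph V) [DecidableRel G.Adj] (e : Sym2 V) : ℕ :=
  ((G.cliqueFinset 3).filter (fun s => e ∈ s.sym2)).card

/-- `Δ = max_e Δ(e)`: the maximum, over all edges of `G`, of the number of
triangles containing that edge. -/
def maxTriEdge (G : SimpleGraph V) [DecidableRel G.Adj] : ℕ :=
  G.edgeFinset.sup (triEdgeCount G)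

end Defs

universe u

section BernoulliProduct

variable {ι : Type*} [Fintype ι]

theorem bernWeight_nonneg {p : ℝ} (h0 : 0 ≤ p) (h1 : p ≤ 1) (ω : ι → Bool) :
    0 ≤ bernWeight p ω :=
  prod_nonneg fun e _ => by split_ifs <;> linarith

variable [DecidableEq ι]

theorem sum_bernWeight (p : ℝ) : ∑ ω : ι → Bool, bernWeight p ω = 1 := by
  have h := Fintype.prod_sum (fun (_ : ι) (b : Bool) => if b then p else 1 - p)
  simpa [bernWeight] using h.symm

theorem bernExpect_const (p c : ℝ) : bernExpect (ι := ι) p (fun _ => c) = c := by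
  simp [bernExpect, ← sum_mul, sum_bernWeight]

theorem bernExpect_mono {p : ℝ} (h0 : 0 ≤ p) (h1 : p ≤ 1) {f g : (ι → Bool) → ℝ}
    (h : ∀ ω, f ω ≤ g ω) : bernExpect p f ≤ bernExpect p g :=
  sum_le_sum fun ω _ => mul_le_mul_of_nonneg_left (h ω) (bernWeight_nonneg h0 h1 ω)

theorem bernExpect_nonneg {p : ℝ} (h0 : 0 ≤ p) (h1 : p ≤ 1) {f : (ι → Bool) → ℝ}
    (h : ∀ ω, 0 ≤ f ω) : 0 ≤ bernExpect p f :=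
  sum_nonneg fun ω _ => mul_nonneg (bernWeight_nonneg h0 h1 ω) (h ω)

theorem bernExpect_finset_sum {τ : Type*} (p : ℝ) (S : Finset τ) (f : τ → (ι → Bool) → ℝ) :
    bernExpect p (fun ω => ∑ s ∈ S, f s ω) = ∑ s ∈ S, bernExpect p (f s) := by
  simp only [bernExpect, mul_sum]
  exact sum_comm

theorem bernExpect_const_mul (p c : ℝ) (f : (ι → Bool) → ℝ) :
    bernExpect p (fun ω => c * f ω) = c * bernExpect p f := by
  simp only [bernExpect, mul_sum]
  exact sum_congr rfl fun ω _ => by ring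

theorem bernExpect_sub (p : ℝ) (f g : (ι → Bool) → ℝ) :
    bernExpect p (fun ω => f ω - g ω) = bernExpect p f - bernExpect p g := by
  simp only [bernExpect, ← sum_sub_distrib, mul_sub]

/-- Markov's inequality for the product Bernoulli measure. -/
theorem bernProb_mul_le_bernExpect {p : ℝ} (h0 : 0 ≤ p) (h1 : p ≤ 1) {A : (ι → Bool) → Prop}
    {f : (ι → Bool) → ℝ} (hf : ∀ ω, 0 ≤ f ω) {c : ℝ} (hA : ∀ ω, A ω → c ≤ f ω) :
    bernProb p A * c ≤ bernExpect p f := by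
  rw [bernProb, bernExpect, sum_mul]
  refine sum_le_sum fun ω _ => ?_
  have hw := bernWeight_nonneg h0 h1 ω
  split_ifs with h
  · exact mul_le_mul_of_nonneg_left (hA ω h) hw
  · simpa using mul_nonneg hw (hf ω)

theorem bernProb_le_add {p : ℝ} (h0 : 0 ≤ p) (h1 : p ≤ 1) {A B C : (ι → Bool) → Prop}
    (h : ∀ ω, A ω → B ω ∨ C ω) : bernProb p A ≤ bernProb p B + bernProb p C := by
  rw [bernProb, bernProb, bernProb, ← sum_add_distrib]
  refine sum_le_sum fun ω _ => ?_
  have hw := bernWeight_nonneg h0 h1 ω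
  have := h ω
  split_ifs <;> first | linarith | tauto

/-- Harris' inequality for the product Bernoulli measure. -/
theorem bernExpect_mul_le_of_monotone {p : ℝ} (h0 : 0 ≤ p) (h1 : p ≤ 1)
    {f g : (ι → Bool) → ℝ} (hf0 : 0 ≤ f) (hg0 : 0 ≤ g) (hf : Monotone f) (hg : Monotone g) :
    bernExpect p f * bernExpect p g ≤ bernExpect p (fun ω => f ω * g ω) := by
  have h := fkg (μ := bernWeight (ι := ι) p) (f := f) (g := g)
    (fun ω => bernWeight_nonneg h0 h1 ω) hf0 hg0 hf hg
    (fun a b => by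
      simp only [bernWeight, ← prod_mul_distrib]
      refine le_of_eq (prod_congr rfl fun e _ => ?_)
      rcases ha : a e <;> rcases hb : b e <;> simp [ha, hb, mul_comm])
  simpa [bernExpect, sum_bernWeight] using h

/-- The indicator that all coordinates in `A` are kept. -/
def keepIndicator (A : Finset ι) (ω : ι → Bool) : ℝ :=
  ∏ e ∈ A, if ω e then (1 : ℝ) else 0

/-- The outcome `ω` with all coordinates in `A` kept in addition. -/
def keepAlso (A : Finset ι) (ω : ι → Bool) : ι → Bool :=
  fun e => if e ∈ A then true else ω e

theorem keepIndicator_eq_ite (A : Finset ι) (ω : ι → Bool) :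
    keepIndicator A ω = if ∀ e ∈ A, ω e = true then 1 else 0 := by
  rw [keepIndicator, prod_ite_zero]
  simp

theorem keepIndicator_nonneg (A : Finset ι) (ω : ι → Bool) : 0 ≤ keepIndicator A ω := by
  rw [keepIndicator_eq_ite]
  split_ifs <;> norm_num

theorem keepIndicator_mono (A : Finset ι) : Monotone (keepIndicator A) := by
  intro ω ω' h
  simp only [keepIndicator_eq_ite]
  split_ifs with h1 h2
  · exact le_rfl
  · exact absurd (fun e he => Bool.eq_true_of_true_le (h1 e he ▸ h e)) h2
  · norm_num
  · exact le_rfl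

theorem keepIndicator_mul (A B : Finset ι) (ω : ι → Bool) :
    keepIndicator A ω * keepIndicator B ω = keepIndicator (A ∪ B) ω := by
  simp only [keepIndicator_eq_ite, mem_union, or_imp, forall_and]
  split_ifs <;> simp_all

theorem keepIndicator_keepAlso (A B : Finset ι) (ω : ι → Bool) :
    keepIndicator B (keepAlso A ω) = keepIndicator (B \ A) ω := by
  simp only [keepIndicator_eq_ite, keepAlso, mem_sdiff]
  congr 1
  grind

theorem bernExpect_singleton_mul (p : ℝ) (e : ι) (f : (ι → Bool) → ℝ) :
    bernExpect p (fun ω => (if ω e then 1 else 0) * f ω) =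
      p * bernExpect p (fun ω => f (Function.update ω e true)) := by
  have hw : ∀ (b : Bool) (ω : {j // j ≠ e} → Bool),
      bernWeight p ((Equiv.funSplitAt e Bool).symm (b, ω)) =
        (if b then p else 1 - p) * bernWeight p ω := by
    intro b ω
    rw [bernWeight, bernWeight, ← mul_prod_erase univ _ (mem_univ e)]
    congr 1
    · simp
    · rw [prod_subtype (univ.erase e) (p := fun j => j ≠ e) (by simp)]
      exact prod_congr rfl fun j _ => by simp [j.2]
  have hu : ∀ (b : Bool) (ω : {j // j ≠ e} → Bool),
      Function.update ((Equiv.funSplitAt e Bool).symm (b, ω)) e true =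
        (Equiv.funSplitAt e Bool).symm (true, ω) := by
    intro b ω
    ext j
    by_cases hj : j = e
    · subst hj; simp
    · simp [hj]
  have hv : ∀ (b : Bool) (ω : {j // j ≠ e} → Bool),
      (Equiv.funSplitAt e Bool).symm (b, ω) e = b := fun b ω => by simp
  simp only [bernExpect]
  rw [← (Equiv.funSplitAt e Bool).symm.sum_comp, ← (Equiv.funSplitAt e Bool).symm.sum_comp,
    Fintype.sum_prod_type, Fintype.sum_prod_type]
  simp only [hw, hu, hv, Fintype.sum_bool, if_true, Bool.false_eq_true, if_false, zero_mul,
    mul_zero, sum_const_zero, one_mul, add_zero, mul_assoc, ← mul_sum]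
  ring

theorem bernExpect_keepIndicator_mul (p : ℝ) (A : Finset ι) (f : (ι → Bool) → ℝ) :
    bernExpect p (fun ω => keepIndicator A ω * f ω) =
      p ^ #A * bernExpect p (fun ω => f (keepAlso A ω)) := by
  induction A using Finset.induction_on generalizing f with
  | empty =>
    have h : ∀ ω : ι → Bool, keepAlso ∅ ω = ω := fun ω => by ext; simp [keepAlso]
    simp [keepIndicator, h]
  | insert e A he ih =>
    have h1 : ∀ ω, keepIndicator A (Function.update ω e true) = keepIndicator A ω := by
      intro ω
      refine prod_congr rfl fun j hj => ?_
      rw [Function.update_of_ne (by rintro rfl; exact he hj)]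
    have h2 : ∀ ω, Function.update (keepAlso A ω) e true = keepAlso (insert e A) ω := by
      intro ω
      ext j
      by_cases hj : j = e
      · subst hj; simp [keepAlso]
      · simp [keepAlso, hj]
    have h3 := bernExpect_singleton_mul p e (fun ω => keepIndicator A ω * f ω)
    simp only [h1] at h3
    rw [ih] at h3
    simp only [h2] at h3
    rw [card_insert_of_notMem he, pow_succ', mul_assoc, ← h3]
    congr 1
    ext ω
    rw [keepIndicator, prod_insert he, mul_assoc, keepIndicator]

theorem bernExpect_keepIndicator (p : ℝ) (A : Finset ι) :
    bernExpect p (keepIndicator A) = p ^ #A := by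
  simpa [bernExpect_const] using bernExpect_keepIndicator_mul p A (fun _ => 1)

end BernoulliProduct

section KeptCount

variable {ι τ : Type*} [DecidableEq ι]

/-- The expected number of kept sets meeting `F`, given that all of `F` is kept. -/
noncomputable def touchSum (p : ℝ) (S : Finset τ) (E : τ → Finset ι) (F : Finset ι) : ℝ :=
  ∑ s ∈ S with ¬ Disjoint (E s) F, p ^ #(E s \ F)

theorem sum_pow_card_sdiff_le {p : ℝ} (h0 : 0 ≤ p) (S : Finset τ) (E : τ → Finset ι)
    (F : Finset ι) :
    ∑ s ∈ S, p ^ #(E s \ F) ≤ ∑ s ∈ S, p ^ #(E s) + touchSum p S E F := by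
  rw [← sum_filter_add_sum_filter_not S (fun s => Disjoint (E s) F), touchSum]
  gcongr ?_ + _
  calc ∑ s ∈ S with Disjoint (E s) F, p ^ #(E s \ F)
      = ∑ s ∈ S with Disjoint (E s) F, p ^ #(E s) :=
        sum_congr rfl fun s hs => by rw [sdiff_eq_self_of_disjoint (mem_filter.1 hs).2]
    _ ≤ _ := sum_le_sum_of_subset_of_nonneg (filter_subset _ _) fun _ _ _ => by positivity

variable [Fintype ι]

/-- The number of indices `s ∈ S` whose coordinate set `E s` is entirely kept. -/
def keptCount (S : Finset τ) (E : τ → Finset ι) (ω : ι → Bool) : ℝ :=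
  ∑ s ∈ S, keepIndicator (E s) ω

theorem keptCount_nonneg (S : Finset τ) (E : τ → Finset ι) (ω : ι → Bool) :
    0 ≤ keptCount S E ω :=
  sum_nonneg fun s _ => keepIndicator_nonneg (E s) ω

theorem keptCount_mono (S : Finset τ) (E : τ → Finset ι) : Monotone (keptCount S E) :=
  fun _ _ h => sum_le_sum fun s _ => keepIndicator_mono (E s) h

theorem bernExpect_keptCount (p : ℝ) (S : Finset τ) (E : τ → Finset ι) :
    bernExpect p (keptCount S E) = ∑ s ∈ S, p ^ #(E s) := by
  simp only [← bernExpect_keepIndicator]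
  exact bernExpect_finset_sum p S fun s => keepIndicator (E s)

theorem bernExpect_keepIndicator_mul_keptCount_pow_le {p : ℝ} (h0 : 0 ≤ p)
    (S : Finset τ) (E : τ → Finset ι) {k M : ℕ} {D : ℝ} (hD0 : 0 ≤ D)
    (hE : ∀ s ∈ S, #(E s) ≤ k) (hD : ∀ F : Finset ι, #F ≤ M → touchSum p S E F ≤ D)
    (j : ℕ) (F : Finset ι) (hF : #F + k * j ≤ M) :
    bernExpect p (fun ω => keepIndicator F ω * keptCount S E ω ^ j) ≤
      p ^ #F * (∑ s ∈ S, p ^ #(E s) + D) ^ j := by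
  have hμ : 0 ≤ ∑ s ∈ S, p ^ #(E s) := sum_nonneg fun _ _ => by positivity
  induction j generalizing F with
  | zero => simp [bernExpect_keepIndicator]
  | succ j ih =>
    have h1 : (fun ω => keepIndicator F ω * keptCount S E ω ^ (j + 1)) =
        fun ω => ∑ s ∈ S, keepIndicator (F ∪ E s) ω * keptCount S E ω ^ j := by
      ext ω
      rw [← sum_mul]
      simp only [← keepIndicator_mul]
      rw [← mul_sum, pow_succ', keptCount, mul_assoc]
    rw [h1, bernExpect_finset_sum]
    calc ∑ s ∈ S, bernExpect p (fun ω => keepIndicator (F ∪ E s) ω * keptCount S E ω ^ j)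
        ≤ ∑ s ∈ S, p ^ #(F ∪ E s) * (∑ s ∈ S, p ^ #(E s) + D) ^ j := by
          refine sum_le_sum fun s hs => ih _ ?_
          have := card_union_le F (E s)
          have := hE s hs
          rw [mul_add] at hF
          omega
      _ = p ^ #F * (∑ s ∈ S, p ^ #(E s) + D) ^ j * ∑ s ∈ S, p ^ #(E s \ F) := by
          rw [mul_sum]
          refine sum_congr rfl fun s _ => ?_
          rw [← union_sdiff_self_eq_union, card_union_of_disjoint disjoint_sdiff, pow_add]
          ring
      _ ≤ p ^ #F * (∑ s ∈ S, p ^ #(E s) + D) ^ j * (∑ s ∈ S, p ^ #(E s) + D) := by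
          gcongr
          exact (sum_pow_card_sdiff_le h0 S E F).trans (by linarith [hD F (by omega)])
      _ = _ := by ring

/-- Upper tail bound by the method of moments. -/
theorem bernProb_keptCount_upper {p : ℝ} (h0 : 0 ≤ p) (h1 : p ≤ 1)
    (S : Finset τ) (E : τ → Finset ι) {k m : ℕ} {D : ℝ} (hD0 : 0 ≤ D)
    (hE : ∀ s ∈ S, #(E s) ≤ k) (hD : ∀ F : Finset ι, #F ≤ k * m → touchSum p S E F ≤ D)
    {a : ℝ} (ha : 0 < a) :
    bernProb p (fun ω => a ≤ keptCount S E ω) ≤ ((∑ s ∈ S, p ^ #(E s) + D) / a) ^ m := by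
  have h := bernExpect_keepIndicator_mul_keptCount_pow_le h0 S E hD0 hE hD m ∅ (by simp)
  simp only [keepIndicator, prod_empty, one_mul, card_empty, pow_zero] at h
  rw [div_pow, le_div_iff₀ (by positivity)]
  exact (bernProb_mul_le_bernExpect h0 h1 (fun ω => pow_nonneg (keptCount_nonneg S E ω) m)
    fun ω hω => pow_le_pow_left₀ ha.le hω m).trans h

theorem keptCount_keepAlso_le (S : Finset τ) (E : τ → Finset ι) (A : Finset ι) (ω : ι → Bool) :
    keptCount S E (keepAlso A ω) ≤
      keptCount S E ω + keptCount {s ∈ S | ¬ Disjoint (E s) A} (fun s => E s \ A) ω := by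
  simp only [keptCount, keepIndicator_keepAlso]
  rw [← sum_filter_add_sum_filter_not S (fun s => Disjoint (E s) A)]
  gcongr ?_ + _
  calc ∑ s ∈ S with Disjoint (E s) A, keepIndicator (E s \ A) ω
      = ∑ s ∈ S with Disjoint (E s) A, keepIndicator (E s) ω :=
        sum_congr rfl fun s hs => by rw [sdiff_eq_self_of_disjoint (mem_filter.1 hs).2]
    _ ≤ _ := sum_le_sum_of_subset_of_nonneg (filter_subset _ _)
        fun s _ _ => keepIndicator_nonneg (E s) ω

theorem bernExpect_keepIndicator_mul_exp_ge {p : ℝ} (h0 : 0 ≤ p) (h1 : p ≤ 1)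
    (S : Finset τ) (E : τ → Finset ι) (A : Finset ι) {x : ℝ} (hx : 0 ≤ x) :
    p ^ #A * (bernExpect p (fun ω => Real.exp (-x * keptCount S E ω)) *
        (1 - x * touchSum p S E A)) ≤
      bernExpect p (fun ω => keepIndicator A ω * Real.exp (-x * keptCount S E ω)) := by
  rw [bernExpect_keepIndicator_mul]
  refine mul_le_mul_of_nonneg_left ?_ (by positivity)
  set Y := keptCount {s ∈ S | ¬ Disjoint (E s) A} (fun s => E s \ A) with hY
  have hEY : bernExpect p Y = touchSum p S E A := bernExpect_keptCount _ _ _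
  have hY0 : ∀ ω, 0 ≤ Y ω := keptCount_nonneg _ _
  have hH := bernExpect_mul_le_of_monotone h0 h1 (f := Y)
    (g := fun ω => 1 - Real.exp (-x * keptCount S E ω)) hY0
    (fun ω => by
      have : Real.exp (-x * keptCount S E ω) ≤ 1 := Real.exp_le_one_iff.2 (by
        have := mul_nonneg hx (keptCount_nonneg S E ω); linarith)
      simpa using this)
    (keptCount_mono _ _)
    (fun ω ω' h => by
      have := mul_le_mul_of_nonneg_left (keptCount_mono S E h) hx
      have : Real.exp (-x * keptCount S E ω') ≤ Real.exp (-x * keptCount S E ω) :=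
        Real.exp_le_exp.2 (by linarith)
      exact sub_le_sub_left this 1)
  simp only [mul_sub, mul_one] at hH
  rw [bernExpect_sub, bernExpect_sub, bernExpect_const, hEY] at hH
  calc bernExpect p (fun ω => Real.exp (-x * keptCount S E ω)) * (1 - x * touchSum p S E A)
      ≤ bernExpect p (fun ω => Real.exp (-x * keptCount S E ω)) -
          x * bernExpect p (fun ω => Y ω * Real.exp (-x * keptCount S E ω)) := by
        nlinarith
    _ = bernExpect p (fun ω => Real.exp (-x * keptCount S E ω) -
          x * (Y ω * Real.exp (-x * keptCount S E ω))) := by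
        rw [bernExpect_sub, bernExpect_const_mul]
    _ ≤ _ := bernExpect_mono h0 h1 fun ω => by
        calc Real.exp (-x * keptCount S E ω) - x * (Y ω * Real.exp (-x * keptCount S E ω))
            = Real.exp (-x * keptCount S E ω) * (-x * Y ω + 1) := by ring
          _ ≤ Real.exp (-x * keptCount S E ω) * Real.exp (-x * Y ω) := by
              gcongr
              exact Real.add_one_le_exp _
          _ ≤ Real.exp (-x * keptCount S E (keepAlso A ω)) := by
              rw [← Real.exp_add, Real.exp_le_exp]
              have := mul_le_mul_of_nonneg_left (keptCount_keepAlso_le S E A ω) hx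
              rw [← hY] at this
              linarith

theorem bernExpect_exp_neg_mul_keptCount_le {p : ℝ} (h0 : 0 ≤ p) (h1 : p ≤ 1)
    (S : Finset τ) (E : τ → Finset ι) {D : ℝ}
    (hD : ∀ s ∈ S, touchSum p S E (E s) ≤ D) {x : ℝ} (hx : 0 ≤ x) :
    bernExpect p (fun ω => Real.exp (-x * keptCount S E ω)) ≤
      Real.exp (-((∑ s ∈ S, p ^ #(E s)) * (x - x ^ 2 * D / 2))) := by
  set μ := ∑ s ∈ S, p ^ #(E s) with hμ
  set ψ : ℝ → ℝ := fun x => bernExpect p (fun ω => Real.exp (-x * keptCount S E ω)) with hψ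
  have hψ' : ∀ y, HasDerivAt ψ
      (-bernExpect p (fun ω => keptCount S E ω * Real.exp (-y * keptCount S E ω))) y := by
    intro y
    simp only [hψ, bernExpect]
    rw [← sum_neg_distrib]
    refine HasDerivAt.fun_sum fun ω _ => ?_
    have := ((((hasDerivAt_id y).neg).mul_const (keptCount S E ω)).exp).const_mul
      (bernWeight p ω)
    exact this.congr_deriv (by simp only [Pi.neg_apply, id]; ring)
  have hψ0 : ∀ y, 0 ≤ ψ y := fun y => bernExpect_nonneg h0 h1 fun ω => (Real.exp_pos _).le
  have hder : ∀ y, 0 ≤ y → ψ y * (μ * (1 - y * D)) ≤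
      bernExpect p (fun ω => keptCount S E ω * Real.exp (-y * keptCount S E ω)) := by
    intro y hy
    simp only [keptCount, sum_mul]
    rw [bernExpect_finset_sum]
    rw [hμ, sum_mul, mul_sum]
    refine sum_le_sum fun s hs => ?_
    refine le_trans ?_ (bernExpect_keepIndicator_mul_exp_ge h0 h1 S E (E s) hy)
    have h2 : ψ y * (1 - y * D) ≤ ψ y * (1 - y * touchSum p S E (E s)) := by
      have := hD s hs
      have := hψ0 y
      gcongr
    calc ψ y * (p ^ #(E s) * (1 - y * D)) = p ^ #(E s) * (ψ y * (1 - y * D)) := by ring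
      _ ≤ _ := mul_le_mul_of_nonneg_left h2 (by positivity)
  set g : ℝ → ℝ := fun y => ψ y * Real.exp (μ * (y - y ^ 2 * D / 2)) with hg
  have hg' : ∀ y, HasDerivAt g
      (-bernExpect p (fun ω => keptCount S E ω * Real.exp (-y * keptCount S E ω)) *
          Real.exp (μ * (y - y ^ 2 * D / 2)) +
        ψ y * (Real.exp (μ * (y - y ^ 2 * D / 2)) * (μ * (1 - y * D)))) y := by
    intro y
    refine (hψ' y).mul (HasDerivAt.exp (HasDerivAt.const_mul μ ?_))
    have := (hasDerivAt_id y).sub ((((hasDerivAt_id y).pow 2).mul_const D).div_const 2)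
    exact this.congr_deriv (by simp; ring)
  have hanti : AntitoneOn g (Set.Ici 0) := by
    refine antitoneOn_of_deriv_nonpos (convex_Ici 0)
      (fun y _ => (hg' y).continuousAt.continuousWithinAt)
      (fun y _ => (hg' y).differentiableAt.differentiableWithinAt) fun y hy => ?_
    rw [interior_Ici] at hy
    rw [(hg' y).deriv]
    have := mul_le_mul_of_nonneg_right (hder y (le_of_lt hy))
      (Real.exp_pos (μ * (y - y ^ 2 * D / 2))).le
    linarith
  have hle := hanti (Set.mem_Ici.2 le_rfl) (Set.mem_Ici.2 hx) hx
  simp only [hg, hψ, neg_zero, zero_mul, Real.exp_zero, bernExpect_const] at hle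
  rw [Real.exp_neg, ← one_div, le_div_iff₀ (Real.exp_pos _)]
  simpa using hle

/-- Lower tail bound of Janson type. -/
theorem bernProb_keptCount_lower {p : ℝ} (h0 : 0 ≤ p) (h1 : p ≤ 1)
    (S : Finset τ) (E : τ → Finset ι) {D : ℝ} (hD0 : 0 < D)
    (hD : ∀ s ∈ S, touchSum p S E (E s) ≤ D) {ε : ℝ} (hε : 0 ≤ ε) :
    bernProb p (fun ω => keptCount S E ω ≤ (1 - ε) * ∑ s ∈ S, p ^ #(E s)) ≤
      Real.exp (-(ε ^ 2 * (∑ s ∈ S, p ^ #(E s)) / (2 * D))) := by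
  set μ := ∑ s ∈ S, p ^ #(E s) with hμ
  have hx : 0 ≤ ε / D := by positivity
  have hM := bernProb_mul_le_bernExpect h0 h1
    (A := fun ω => keptCount S E ω ≤ (1 - ε) * μ)
    (f := fun ω => Real.exp (-(ε / D) * keptCount S E ω))
    (c := Real.exp (-(ε / D) * ((1 - ε) * μ))) (fun ω => (Real.exp_pos _).le)
    (fun ω hω => Real.exp_le_exp.2 (by
      have := mul_le_mul_of_nonneg_left hω hx
      linarith))
  have h2 := hM.trans (bernExpect_exp_neg_mul_keptCount_le h0 h1 S E hD hx)
  rw [← le_div_iff₀ (Real.exp_pos _), ← Real.exp_sub] at h2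
  refine h2.trans (le_of_eq ?_)
  congr 1
  rw [← hμ]
  field_simp
  ring

end KeptCount

section Triangles

variable {V : Type*} [Fintype V] [DecidableEq V] (G : SimpleGraph V) [DecidableRel G.Adj]

/-- The edges of `G` with both endpoints in `s`. -/
def innerEdges (s : Finset V) : Finset {e : Sym2 V // e ∈ G.edgeFinset} :=
  univ.filter fun e => (e : Sym2 V) ∈ s.sym2

theorem triCount_eq_keptCount :
    triCount G = keptCount (G.cliqueFinset 3) (innerEdges G) := rfl

theorem card_innerEdges {s : Finset V} (hs : s ∈ G.cliqueFinset 3) : #(innerEdges G s) = 3 := by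
  rw [SimpleGraph.mem_cliqueFinset_iff, SimpleGraph.is3Clique_iff] at hs
  obtain ⟨a, b, c, hab, hac, hbc, rfl⟩ := hs
  have h : (innerEdges G {a, b, c}).map (Function.Embedding.subtype _) =
      {s(a, b), s(a, c), s(b, c)} := by
    ext e
    induction e using Sym2.ind with
    | _ x y =>
      simp only [innerEdges, mem_map, mem_filter, mem_univ, true_and, Subtype.exists,
        Function.Embedding.subtype_apply, SimpleGraph.mem_edgeFinset, SimpleGraph.mem_edgeSet,
        exists_and_right, exists_eq_right, mem_insert, mem_singleton, Sym2.eq_iff, mk_mem_sym2_iff,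
        exists_prop]
      have := hab.symm
      have := hac.symm
      have := hbc.symm
      have hl : ∀ v, ¬ G.Adj v v := fun v => G.irrefl
      constructor
      · rintro ⟨h, rfl | rfl | rfl, rfl | rfl | rfl⟩ <;> first | exact absurd h (hl _) | simp
      · rintro ((⟨rfl, rfl⟩ | ⟨rfl, rfl⟩) | (⟨rfl, rfl⟩ | ⟨rfl, rfl⟩) |
          (⟨rfl, rfl⟩ | ⟨rfl, rfl⟩)) <;> simp_all
  rw [← card_map (Function.Embedding.subtype _), h, card_eq_three]
  have := hab.ne
  have := hac.ne
  have := hbc.ne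
  exact ⟨_, _, _, by grind, by grind, by grind, rfl⟩

theorem eq_union_toFinset_of_mem_innerEdges {s : Finset V} (hs : s ∈ G.cliqueFinset 3)
    {e f : {e : Sym2 V // e ∈ G.edgeFinset}} (he : e ∈ innerEdges G s)
    (hf : f ∈ innerEdges G s) (hef : e ≠ f) :
    (e : Sym2 V).toFinset ∪ (f : Sym2 V).toFinset = s := by
  have hcard : ∀ e : {e : Sym2 V // e ∈ G.edgeFinset}, #(e : Sym2 V).toFinset = 2 := fun e =>
    Sym2.card_toFinset_of_not_isDiag _
      (G.not_isDiag_of_mem_edgeFinset e.2)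
  have hsub : ∀ e ∈ innerEdges G s, (e : Sym2 V).toFinset ⊆ s := by
    intro e he x hx
    rw [innerEdges, mem_filter, mem_sym2_iff] at he
    exact he.2 x (Sym2.mem_toFinset.1 hx)
  refine eq_of_subset_of_card_le (union_subset (hsub e he) (hsub f hf)) ?_
  rw [(SimpleGraph.mem_cliqueFinset_iff.1 hs).card_eq]
  by_contra! hlt
  have h1 : (e : Sym2 V).toFinset = (e : Sym2 V).toFinset ∪ (f : Sym2 V).toFinset :=
    eq_of_subset_of_card_le subset_union_left (by rw [hcard]; omega)
  have h2 : (f : Sym2 V).toFinset = (e : Sym2 V).toFinset ∪ (f : Sym2 V).toFinset :=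
    eq_of_subset_of_card_le subset_union_right (by rw [hcard]; omega)
  refine hef (Subtype.ext (Sym2.ext fun x => ?_))
  rw [← Sym2.mem_toFinset, ← Sym2.mem_toFinset, h1, ← h2]

theorem card_filter_two_le_card_inter (F : Finset {e : Sym2 V // e ∈ G.edgeFinset}) :
    #{s ∈ G.cliqueFinset 3 | 2 ≤ #(innerEdges G s ∩ F)} ≤ #F ^ 2 := by
  rw [sq, ← card_product]
  refine (card_le_card fun s hs => ?_).trans
    (card_image_le (f := fun x => (x.1 : Sym2 V).toFinset ∪ (x.2 : Sym2 V).toFinset))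
  rw [mem_filter] at hs
  obtain ⟨e, he, f, hf, hef⟩ := one_lt_card.1 hs.2
  rw [mem_inter] at he hf
  exact mem_image.2 ⟨(e, f), mem_product.2 ⟨he.2, hf.2⟩,
    eq_union_toFinset_of_mem_innerEdges G hs.1 he.1 hf.1 hef⟩

theorem card_filter_not_disjoint_innerEdges_le (F : Finset {e : Sym2 V // e ∈ G.edgeFinset}) :
    #{s ∈ G.cliqueFinset 3 | ¬ Disjoint (innerEdges G s) F} ≤ #F * maxTriEdge G := by
  have hsub : {s ∈ G.cliqueFinset 3 | ¬ Disjoint (innerEdges G s) F} ⊆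
      F.biUnion fun e => {s ∈ G.cliqueFinset 3 | (e : Sym2 V) ∈ s.sym2} := by
    intro s hs
    rw [mem_filter, not_disjoint_iff] at hs
    obtain ⟨hs, e, he, heF⟩ := hs
    exact mem_biUnion.2 ⟨e, heF, mem_filter.2 ⟨hs, (mem_filter.1 he).2⟩⟩
  exact (card_le_card hsub).trans (card_biUnion_le_card_mul _ _ _ fun e _ =>
    le_sup (f := triEdgeCount G) e.2)

theorem touchSum_innerEdges_le {p : ℝ} (h0 : 0 ≤ p) (h1 : p ≤ 1)
    (hΔ : 1 ≤ p ^ 2 * (maxTriEdge G : ℝ)) (F : Finset {e : Sym2 V // e ∈ G.edgeFinset}) :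
    touchSum p (G.cliqueFinset 3) (innerEdges G) F ≤
      2 * (#F : ℝ) ^ 2 * (p ^ 2 * (maxTriEdge G : ℝ)) := by
  have hterm : ∀ s ∈ (G.cliqueFinset 3).filter (fun s => ¬ Disjoint (innerEdges G s) F),
      p ^ #(innerEdges G s \ F) ≤ p ^ 2 + if 2 ≤ #(innerEdges G s ∩ F) then 1 else 0 := by
    intro s hs
    split_ifs with h
    · have := pow_le_one₀ (n := #(innerEdges G s \ F)) h0 h1
      have := sq_nonneg p
      linarith
    · rw [add_zero]
      refine pow_le_pow_of_le_one h0 h1 ?_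
      have := card_sdiff_add_card_inter (innerEdges G s) F
      have := card_innerEdges G (mem_filter.1 hs).1
      omega
  have hsq : (#F : ℝ) ≤ (#F : ℝ) ^ 2 := by exact_mod_cast Nat.le_self_pow two_ne_zero #F
  have hA : (#{s ∈ G.cliqueFinset 3 | ¬ Disjoint (innerEdges G s) F} : ℝ) ≤
      #F * maxTriEdge G := by
    exact_mod_cast card_filter_not_disjoint_innerEdges_le G F
  have hB : (#{s ∈ G.cliqueFinset 3 | 2 ≤ #(innerEdges G s ∩ F)} : ℝ) ≤ (#F : ℝ) ^ 2 := by
    exact_mod_cast card_filter_two_le_card_inter G F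
  calc touchSum p (G.cliqueFinset 3) (innerEdges G) F
      ≤ ∑ s ∈ G.cliqueFinset 3 with ¬ Disjoint (innerEdges G s) F,
          (p ^ 2 + if 2 ≤ #(innerEdges G s ∩ F) then 1 else 0) := sum_le_sum hterm
    _ ≤ #{s ∈ G.cliqueFinset 3 | ¬ Disjoint (innerEdges G s) F} * p ^ 2 +
          #{s ∈ G.cliqueFinset 3 | 2 ≤ #(innerEdges G s ∩ F)} := by
        rw [sum_add_distrib, sum_const, nsmul_eq_mul, sum_boole]
        gcongr
        exact filter_subset _ _
    _ ≤ #F * maxTriEdge G * p ^ 2 + (#F : ℝ) ^ 2 := by gcongr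
    _ = #F * (p ^ 2 * maxTriEdge G) + (#F : ℝ) ^ 2 * 1 := by ring
    _ ≤ (#F : ℝ) ^ 2 * (p ^ 2 * maxTriEdge G) + (#F : ℝ) ^ 2 * (p ^ 2 * maxTriEdge G) := by
        gcongr
    _ = _ := by ring

theorem bernExpect_triCount (p : ℝ) :
    bernExpect p (triCount G) = p ^ 3 * (#(G.cliqueFinset 3) : ℝ) := by
  rw [triCount_eq_keptCount, bernExpect_keptCount,
    sum_congr rfl fun s hs => by rw [card_innerEdges G hs], sum_const, nsmul_eq_mul, mul_comm]

/-- Two-sided tail bound for the number of surviving triangles, with the order `m` of the moment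
used for the upper tail as a free parameter. -/
theorem bernProb_triCount_le {p : ℝ} (h0 : 0 < p) (h1 : p ≤ 1)
    (hΔ : 1 ≤ p ^ 2 * (maxTriEdge G : ℝ)) {R : ℝ} (hR0 : 0 < R)
    (hR : p * (#(G.cliqueFinset 3) : ℝ) / maxTriEdge G = R) {ε : ℝ} (hε : 0 < ε) (m : ℕ) :
    bernProb p (fun ω =>
        ε * bernExpect p (triCount G) ≤ |triCount G ω - bernExpect p (triCount G)|) ≤
      ((1 + 18 * m ^ 2 / R) / (1 + ε)) ^ m + Real.exp (-(ε ^ 2 * R / 36)) := by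
  set P := p ^ 2 * (maxTriEdge G : ℝ) with hP
  have hP0 : 0 < P := by linarith
  have hmax : (maxTriEdge G : ℝ) ≠ 0 := by
    intro h
    rw [hP, h] at hΔ
    norm_num at hΔ
  have hμ : bernExpect p (triCount G) = R * P := by
    rw [bernExpect_triCount, ← hR, hP]
    field_simp
  have hμ' : ∑ s ∈ G.cliqueFinset 3, p ^ #(innerEdges G s) = R * P := by
    rw [← hμ, triCount_eq_keptCount, bernExpect_keptCount]
  have hcard := fun s (hs : s ∈ G.cliqueFinset 3) => card_innerEdges G hs
  rw [hμ, triCount_eq_keptCount]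
  refine (bernProb_le_add h0.le h1 (B := fun ω =>
    (1 + ε) * (R * P) ≤ keptCount (G.cliqueFinset 3) (innerEdges G) ω) (C := fun ω =>
    keptCount (G.cliqueFinset 3) (innerEdges G) ω ≤ (1 - ε) * (R * P)) fun ω hω => ?_).trans
    (add_le_add ?_ ?_)
  · rcases le_abs'.1 hω with h | h
    · exact Or.inr (by linarith)
    · exact Or.inl (by linarith)
  · have hD : ∀ F : Finset {e : Sym2 V // e ∈ G.edgeFinset}, #F ≤ 3 * m →
        touchSum p (G.cliqueFinset 3) (innerEdges G) F ≤ 2 * (3 * m : ℝ) ^ 2 * P := by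
      intro F hF
      have : (#F : ℝ) ≤ 3 * m := by exact_mod_cast hF
      exact (touchSum_innerEdges_le G h0.le h1 hΔ F).trans (by gcongr)
    refine (bernProb_keptCount_upper h0.le h1 _ _ (by positivity)
      (fun s hs => (hcard s hs).le) hD (by positivity)).trans (le_of_eq ?_)
    rw [hμ']
    congr 1
    field_simp
    ring
  · have hD : ∀ s ∈ G.cliqueFinset 3,
        touchSum p (G.cliqueFinset 3) (innerEdges G) (innerEdges G s) ≤ 18 * P := by
      intro s hs
      refine (touchSum_innerEdges_le G h0.le h1 hΔ _).trans (le_of_eq ?_)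
      rw [hcard s hs, hP]
      norm_num
    have h := bernProb_keptCount_lower h0.le h1 _ _ (by positivity : 0 < 18 * P) hD hε.le
    rw [hμ'] at h
    refine h.trans (le_of_eq ?_)
    congr 2
    field_simp
    ring

end Triangles

/-- For a moment of order proportional to `L` and a ratio `R` at least `L ^ 3`, the two tail
bounds are together at most `exp (-K * L)` once `L` is large. -/
theorem exists_moment_order_tail_le (K : ℝ) {ε : ℝ} (hε : 0 < ε) (hK : 0 < K) :
    ∃ L₀ : ℝ, 1 ≤ L₀ ∧ ∀ L R : ℝ, L₀ ≤ L → L ^ 3 ≤ R → ∃ m : ℕ,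
      ((1 + 18 * m ^ 2 / R) / (1 + ε)) ^ m + Real.exp (-(ε ^ 2 * R / 36)) ≤
        Real.exp (-K * L) := by
  set q : ℝ := (1 + ε / 2) / (1 + ε) with hq
  have hq0 : 0 < q := by positivity
  have hq1 : q < 1 := by rw [hq, div_lt_one (by positivity)]; linarith
  have hlog : 0 < -Real.log q := neg_pos.2 (Real.log_neg hq0 hq1)
  set c : ℝ := (K + 1) / -Real.log q with hc
  have hc0 : 0 < c := by positivity
  refine ⟨1 + 36 * (c + 1) ^ 2 / ε + 36 * (K + 1) / ε ^ 2, ?_, fun L R hL hR => ?_⟩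
  · have : 0 ≤ 36 * (c + 1) ^ 2 / ε + 36 * (K + 1) / ε ^ 2 := by positivity
    linarith
  have ha : 0 ≤ 36 * (c + 1) ^ 2 / ε := by positivity
  have hb : 0 ≤ 36 * (K + 1) / ε ^ 2 := by positivity
  have hL1 : 1 ≤ L := by linarith
  have hL0 : 0 < L := by linarith
  have hR0 : 0 < R := lt_of_lt_of_le (by positivity) hR
  refine ⟨⌈c * L⌉₊, ?_⟩
  set m := ⌈c * L⌉₊ with hm
  have hm1 : c * L ≤ m := Nat.le_ceil _
  have hm2 : (m : ℝ) ≤ (c + 1) * L := by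
    have := Nat.ceil_lt_add_one (a := c * L) (by positivity)
    rw [add_mul]
    linarith
  have hup : 18 * (m : ℝ) ^ 2 / R ≤ ε / 2 := by
    have h36 : 36 * (c + 1) ^ 2 ≤ ε * L := by
      rw [← div_le_iff₀' hε]
      linarith
    rw [div_le_iff₀ hR0]
    calc 18 * (m : ℝ) ^ 2 ≤ 18 * ((c + 1) * L) ^ 2 := by gcongr
      _ = 36 * (c + 1) ^ 2 * (L ^ 2 / 2) := by ring
      _ ≤ ε * L * (L ^ 2 / 2) := by gcongr
      _ = ε / 2 * L ^ 3 := by ring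
      _ ≤ ε / 2 * R := by gcongr
  have h1 : ((1 + 18 * (m : ℝ) ^ 2 / R) / (1 + ε)) ^ m ≤ Real.exp (-(K + 1) * L) := by
    calc ((1 + 18 * (m : ℝ) ^ 2 / R) / (1 + ε)) ^ m ≤ q ^ m := by
          rw [hq]
          gcongr
      _ = Real.exp (m * Real.log q) := by rw [Real.exp_nat_mul, Real.exp_log hq0]
      _ ≤ Real.exp (-(K + 1) * L) := by
          rw [Real.exp_le_exp]
          have h := mul_le_mul_of_nonneg_right hm1 hlog.le
          have h' : c * L * -Real.log q = (K + 1) * L := by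
            rw [hc, mul_right_comm, div_mul_cancel₀ _ hlog.ne']
          linarith
  have h2 : Real.exp (-(ε ^ 2 * R / 36)) ≤ Real.exp (-(K + 1) * L) := by
    rw [Real.exp_le_exp]
    have h36 : 36 * (K + 1) ≤ ε ^ 2 * L := by
      rw [← div_le_iff₀' (by positivity)]
      linarith
    have h3 : L ^ 2 ≤ R := (pow_le_pow_right₀ hL1 (by norm_num)).trans hR
    have : 36 * (K + 1) * L ≤ ε ^ 2 * R := by
      calc 36 * (K + 1) * L ≤ ε ^ 2 * L * L := by gcongr
        _ = ε ^ 2 * L ^ 2 := by ring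
        _ ≤ _ := by gcongr
    linarith
  have h3 : 2 ≤ Real.exp L := by
    have := Real.add_one_le_exp L
    linarith
  calc _ ≤ Real.exp (-(K + 1) * L) * 2 := by linarith
    _ ≤ Real.exp (-(K + 1) * L) * Real.exp L := by gcongr
    _ = Real.exp (-K * L) := by
        rw [← Real.exp_add]
        congr 1
        ring

/-- Theorem 2, Case `p²Δ ≥ 1`.  For any constants `γ, K, ε > 0`
there is an `n₀` such that for every finite simple graph `G` on `n ≥ n₀` vertices,
with `t` triangles and `Δ` the maximal number of triangles sharing a common edge,
and every `p ∈ (0,1]` with `p²Δ ≥ 1` and `p·t/Δ ≥ (log n)^(6+γ)`, the number `T`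
of surviving triangles after keeping each edge independently with probability `p`
satisfies `P(|T - E[T]| ≥ ε·E[T]) ≤ n^(-K)`. -/
theorem approx_triangle_counting_case_large
    (γ : ℝ) (hγ : 0 < γ) (K : ℝ) (hK : 0 < K) (ε : ℝ) (hε : 0 < ε) :
    ∃ n₀ : ℕ, ∀ (V : Type u) [Fintype V] [DecidableEq V]
      (G : SimpleGraph V) [DecidableRel G.Adj] (p : ℝ),
      0 < p → p ≤ 1 →
      n₀ ≤ Fintype.card V →
      1 ≤ p ^ 2 * (maxTriEdge G : ℝ) →
      Real.log (Fintype.card V) ^ ((6 : ℝ) + γ) ≤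
        p * ((G.cliqueFinset 3).card : ℝ) / (maxTriEdge G : ℝ) →
      bernProb p (fun ω =>
          ε * bernExpect p (triCount G) ≤ |triCount G ω - bernExpect p (triCount G)|)
        ≤ (Fintype.card V : ℝ) ^ (-K) := by
  obtain ⟨L₀, hL₀, hmain⟩ := exists_moment_order_tail_le K hε hK
  refine ⟨⌈Real.exp L₀⌉₊, fun V _ _ G _ p h0 h1 hn hΔ hR => ?_⟩
  have hn' : Real.exp L₀ ≤ Fintype.card V := Nat.ceil_le.1 hn
  have hn0 : (0 : ℝ) < Fintype.card V := (Real.exp_pos _).trans_le hn'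
  have hL : L₀ ≤ Real.log (Fintype.card V) := (Real.le_log_iff_exp_le hn0).2 hn'
  have hL1 : 1 ≤ Real.log (Fintype.card V) := hL₀.trans hL
  have hR3 : Real.log (Fintype.card V) ^ 3 ≤
      p * ((G.cliqueFinset 3).card : ℝ) / (maxTriEdge G : ℝ) := by
    refine le_trans ?_ hR
    rw [← Real.rpow_natCast]
    exact Real.rpow_le_rpow_of_exponent_le hL1 (by push_cast; linarith)
  obtain ⟨m, hm⟩ := hmain _ _ hL hR3
  refine (bernProb_triCount_le G h0 h1 hΔ (lt_of_lt_of_le (by positivity) hR3) rfl hε m).trans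
    (hm.trans (le_of_eq ?_))
  rw [Real.rpow_def_of_pos hn0, mul_comm]
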